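/- arXiv:2503.18299 — 5 statements merged into one kernel-verified Lean document; each statement's English description precedes it below -/
import Mathlib

section
/- Let G be a discrete 2-manifold, i.e. a finite simple graph in which, for every vertex v, the subgraph induced on the neighborhood N(v) is connected, 2-regular, and has at least 4 vertices. Then the Ishida–Higuchi triangle curvatures satisfy Gauss–Bonnet: the sum over all triangles {a,b,c} of G of the quantity 1/d(a) + 1/d(b) + 1/d(c) − 1/2 equals the Euler characteristic |V| − |E| + |T|, where |V|, |E|, |T| are the numbers of vertices, edges and triangles of G and d denotes the vertex degree in G. -/
/-- A discrete 2-manifold: a finite simple graph in which, for every vertex `v`,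
the subgraph induced on the neighborhood of `v` is connected, 2-regular,
and has at least 4 vertices. -/
def IsDiscrete2Manifold {V : Type*} [Fintype V] [DecidableEq V]
    (G : SimpleGraph V) [DecidableRel G.Adj] : Prop :=
  ∀ v : V,
    (G.induce (G.neighborSet v)).Connected ∧
    (haveI : DecidableRel (G.induce (G.neighborSet v)).Adj := fun a b => by
        show Decidable (G.Adj a b); infer_instance
      ∀ w : G.neighborSet v, (G.induce (G.neighborSet v)).degree w = 2) ∧
    4 ≤ Fintype.card (G.neighborSet v)

namespace SimpleGraph

open Finset

variable {V : Type*} [Fintype V] [DecidableEq V] (G : SimpleGraph V) [DecidableRel G.Adj]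

/-- The triangles through an edge correspond to the common neighbors of its ends. -/
theorem card_filter_cliqueFinset_three_of_adj {v w : V} (h : G.Adj v w) :
    #{t ∈ G.cliqueFinset 3 | v ∈ t ∧ w ∈ t} =
      #(G.neighborFinset v ∩ G.neighborFinset w) := by
  symm
  refine Finset.card_bij (fun x _ => {v, w, x}) ?_ ?_ ?_
  · intro x hx
    simp only [mem_inter, mem_neighborFinset] at hx
    simp [mem_cliqueFinset_iff, is3Clique_triple_iff, h, hx.1, hx.2]
  · intro x hx y hy hxy
    simp only [mem_inter, mem_neighborFinset] at hx hy
    have hmem : x ∈ ({v, w, y} : Finset V) := hxy ▸ by simp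
    simpa [hx.1.ne', hx.2.ne'] using hmem
  · intro t ht
    simp only [mem_filter, mem_cliqueFinset_iff] at ht
    obtain ⟨ht, hv, hw⟩ := ht
    have hsub : {v, w} ⊆ t := by simp [insert_subset_iff, hv, hw]
    have hcard : #(t \ {v, w}) = 1 := by
      rw [card_sdiff_of_subset hsub, ht.card_eq, card_pair h.ne]
    obtain ⟨x, hx⟩ := card_eq_one.mp hcard
    have htx : {v, w, x} = t := by
      rw [← sdiff_union_of_subset hsub, hx]
      grind
    rw [← htx, is3Clique_triple_iff] at ht
    exact ⟨x, by simp [ht.2.1, ht.2.2], htx⟩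

/-- Summing the triangle counts over the edges at `v` counts every triangle at `v` twice. -/
theorem sum_card_filter_cliqueFinset_three (v : V) :
    ∑ w ∈ G.neighborFinset v, #{t ∈ G.cliqueFinset 3 | v ∈ t ∧ w ∈ t} =
      2 * #{t ∈ G.cliqueFinset 3 | v ∈ t} := by
  have hdouble := sum_card_bipartiteAbove_eq_sum_card_bipartiteBelow
    (s := G.neighborFinset v) (t := {t ∈ G.cliqueFinset 3 | v ∈ t}) (fun w t => w ∈ t)
  simp only [bipartiteAbove, filter_filter] at hdouble
  rw [hdouble, mul_comm, ← smul_eq_mul]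
  refine sum_const_nat fun t ht => ?_
  simp only [mem_filter, mem_cliqueFinset_iff] at ht
  have herase : bipartiteBelow (fun w t => w ∈ t) (G.neighborFinset v) t = t.erase v := by
    ext w
    simp only [mem_bipartiteBelow, mem_neighborFinset, mem_erase]
    exact ⟨fun h => ⟨h.1.ne', h.2⟩, fun h => ⟨ht.1.isClique ht.2 h.2 h.1.symm, h.2⟩⟩
  rw [herase, card_erase_of_mem ht.2, ht.1.card_eq]

end SimpleGraph

namespace IsDiscrete2Manifold

open Finset

variable {V : Type*} [Fintype V] [DecidableEq V] {G : SimpleGraph V} [DecidableRel G.Adj]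

theorem card_common_neighbors (hG : IsDiscrete2Manifold G) {v w : V} (h : G.Adj v w) :
    #(G.neighborFinset v ∩ G.neighborFinset w) = 2 := by
  rw [← (hG v).2.1 ⟨w, h⟩, ← SimpleGraph.card_neighborFinset_eq_degree]
  symm
  refine Finset.card_bij (fun x _ => x.1) ?_ ?_ ?_
  · intro x hx
    rw [SimpleGraph.mem_neighborFinset] at hx
    simp only [mem_inter, SimpleGraph.mem_neighborFinset]
    exact ⟨x.2, hx⟩
  · exact fun _ _ _ _ => Subtype.ext
  · intro x hx
    simp only [mem_inter, SimpleGraph.mem_neighborFinset] at hx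
    refine ⟨⟨x, hx.1⟩, ?_, rfl⟩
    rw [SimpleGraph.mem_neighborFinset]
    exact hx.2

theorem card_triangles_at (hG : IsDiscrete2Manifold G) (v : V) :
    #{t ∈ G.cliqueFinset 3 | v ∈ t} = G.degree v := by
  have h := G.sum_card_filter_cliqueFinset_three v
  rw [sum_const_nat (m := 2) fun w hw => ?_, G.card_neighborFinset_eq_degree] at h
  · omega
  · rw [SimpleGraph.mem_neighborFinset] at hw
    rw [G.card_filter_cliqueFinset_three_of_adj hw, hG.card_common_neighbors hw]

theorem degree_pos (hG : IsDiscrete2Manifold G) (v : V) : 0 < G.degree v := by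
  have h := (hG v).2.2
  rw [SimpleGraph.card_neighborSet_eq_degree] at h
  omega

/-- Each vertex lies in as many triangles as its degree, so summing a vertex function over the
corners of all triangles weights it by the degree. -/
theorem sum_triangles (hG : IsDiscrete2Manifold G) (f : V → ℚ) :
    ∑ t ∈ G.cliqueFinset 3, ∑ a ∈ t, f a = ∑ v, G.degree v * f v := by
  rw [sum_comm' (t' := univ) (s' := fun v => {t ∈ G.cliqueFinset 3 | v ∈ t}) (by simp)]
  simp [hG.card_triangles_at]

theorem three_mul_card_triangles (hG : IsDiscrete2Manifold G) :
    3 * (#(G.cliqueFinset 3) : ℚ) = 2 * #G.edgeFinset := by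
  have h := hG.sum_triangles fun _ => 1
  have hcard : ∀ t ∈ G.cliqueFinset 3, ∑ _a ∈ t, (1 : ℚ) = 3 := fun t ht => by
    simp [((G.mem_cliqueFinset_iff).mp ht).card_eq]
  rw [sum_congr rfl hcard, sum_const, nsmul_eq_mul] at h
  simp only [mul_one] at h
  rw [mul_comm, h]
  exact_mod_cast G.sum_degrees_eq_twice_card_edges

end IsDiscrete2Manifold

/-- Gauss–Bonnet for the Ishida–Higuchi triangle curvatures of a discrete
2-manifold: the sum over all triangles `{a,b,c}` of
`1/d(a) + 1/d(b) + 1/d(c) − 1/2` equals the Euler characteristic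
`|V| − |E| + |T|`. -/
theorem gaussBonnet_triangle_curvature
    {V : Type*} [Fintype V] [DecidableEq V]
    (G : SimpleGraph V) [DecidableRel G.Adj]
    (hG : IsDiscrete2Manifold G) :
    ∑ t ∈ G.cliqueFinset 3, ((∑ a ∈ t, (1 : ℚ) / G.degree a) - 1 / 2)
      = (Fintype.card V : ℚ) - G.edgeFinset.card + (G.cliqueFinset 3).card := by
  have hdeg : ∀ v ∈ Finset.univ, (G.degree v : ℚ) * (1 / G.degree v) = 1 := fun v _ =>
    mul_one_div_cancel (Nat.cast_ne_zero.mpr (hG.degree_pos v).ne')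
  rw [Finset.sum_sub_distrib, hG.sum_triangles, Finset.sum_congr rfl hdeg]
  simp only [Finset.sum_const, Finset.card_univ, nsmul_eq_mul]
  linarith [hG.three_mul_card_triangles]
end

section
/- Let G be a discrete 2-manifold, i.e. a finite simple graph in which, for every vertex v, the subgraph induced on the neighborhood N(v) is connected, 2-regular, and has at least 4 vertices. Define the curvature K(v) = (2 − d(v))/6 + (2/3)·Σ_{w ∈ N(v)} 1/d(w) for each vertex v. Then Gauss–Bonnet holds: Σ_{v ∈ V} K(v) = χ(G) = |V| − |E| + |T|, where |V|, |E|, |T| are the numbers of vertices, edges and triangles of G. -/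
/-- The second-order vertex curvature
`K(v) = (2 − d(v))/6 + (2/3) · Σ_{w ∈ N(v)} 1/d(w)`. -/
def vertexCurvature {V : Type*} [Fintype V] [DecidableEq V]
    (G : SimpleGraph V) [DecidableRel G.Adj] (v : V) : ℚ :=
  ((2 : ℚ) - G.degree v) / 6 + (2 / 3) * ∑ w ∈ G.neighborFinset v, (1 : ℚ) / G.degree w

/-- In a discrete 2-manifold, the endpoints of an edge have exactly two common neighbors. -/
lemma IsDiscrete2Manifold.card_commonNeighbors {V : Type*} [Fintype V] [DecidableEq V]
    {G : SimpleGraph V} [DecidableRel G.Adj] (hG : IsDiscrete2Manifold G)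
    {v w : V} (h : G.Adj v w) :
    (G.neighborFinset v ∩ G.neighborFinset w).card = 2 := by
  have h2 := (hG v).2.1 ⟨w, h⟩
  rw [← h2, ← SimpleGraph.card_neighborFinset_eq_degree]
  symm
  refine Finset.card_bij (fun a _ => a.1) ?_ ?_ ?_
  · intro a ha
    simpa using ⟨a.2, by simpa using ha⟩
  · intro a _ b _ hab
    exact Subtype.ext hab
  · intro b hb
    simp only [Finset.mem_inter, SimpleGraph.mem_neighborFinset] at hb
    exact ⟨⟨b, hb.1⟩, by simpa using hb.2, rfl⟩

/-- The number of triangles through an edge is the number of common neighbors of its endpoints. -/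
lemma card_triangles_through_edge {V : Type*} [Fintype V] [DecidableEq V]
    (G : SimpleGraph V) [DecidableRel G.Adj] {v w : V} (h : G.Adj v w) :
    ((G.cliqueFinset 3).filter (fun t => s(v, w) ∈ t.sym2)).card
      = (G.neighborFinset v ∩ G.neighborFinset w).card := by
  symm
  refine Finset.card_bij (fun u _ => {v, w, u}) ?_ ?_ ?_
  · intro u hu
    simp only [Finset.mem_inter, SimpleGraph.mem_neighborFinset] at hu
    simp [SimpleGraph.mem_cliqueFinset_iff, SimpleGraph.is3Clique_triple_iff, h, hu]
  · intro a ha b hb hab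
    simp only [Finset.mem_inter, SimpleGraph.mem_neighborFinset] at ha hb
    have hmem : a ∈ ({v, w, b} : Finset V) := hab ▸ (by simp)
    simpa [ha.1.ne', ha.2.ne'] using hmem
  · intro t ht
    simp only [Finset.mem_filter, SimpleGraph.mem_cliqueFinset_iff, Finset.mk_mem_sym2_iff] at ht
    obtain ⟨ht, hv, hw⟩ := ht
    obtain ⟨u, hu⟩ : ∃ u, ({v, w, u} : Finset V) = t := by
      have hsub : ({v, w} : Finset V) ⊆ t := by
        simp [Finset.insert_subset_iff, hv, hw]
      have hcard : (t \ {v, w}).card = 1 := by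
        rw [Finset.card_sdiff_of_subset hsub, ht.card_eq, Finset.card_pair h.ne]
      obtain ⟨u, hu⟩ := Finset.card_eq_one.mp hcard
      refine ⟨u, ?_⟩
      rw [← Finset.union_sdiff_of_subset hsub, hu]
      ext x
      simp
    subst hu
    rw [SimpleGraph.is3Clique_triple_iff] at ht
    exact ⟨u, by simp [ht], rfl⟩

/-- A triangle contains exactly three edges. -/
lemma card_edges_of_triangle {V : Type*} [Fintype V] [DecidableEq V]
    (G : SimpleGraph V) [DecidableRel G.Adj] {t : Finset V} (ht : G.IsNClique 3 t) :
    (G.edgeFinset.filter (fun e => e ∈ t.sym2)).card = 3 := by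
  obtain ⟨a, b, c, hab, hac, hbc, rfl⟩ := SimpleGraph.is3Clique_iff.mp ht
  have hset : G.edgeFinset.filter (fun e => e ∈ ({a, b, c} : Finset V).sym2)
      = {s(a, b), s(a, c), s(b, c)} := by
    ext e
    induction e with
    | _ x y =>
      simp only [Finset.mem_filter, SimpleGraph.mem_edgeFinset, SimpleGraph.mem_edgeSet,
        Finset.mk_mem_sym2_iff, Finset.mem_insert, Finset.mem_singleton, Sym2.eq_iff]
      constructor
      · rintro ⟨h, rfl | rfl | rfl, rfl | rfl | rfl⟩ <;> simp_all
      · rintro ((⟨rfl, rfl⟩ | ⟨rfl, rfl⟩) | (⟨rfl, rfl⟩ | ⟨rfl, rfl⟩) | (⟨rfl, rfl⟩ | ⟨rfl, rfl⟩))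
          <;> simp [hab, hac, hbc, hab.symm, hac.symm, hbc.symm]
  rw [hset, Finset.card_eq_three]
  refine ⟨_, _, _, ?_, ?_, ?_, rfl⟩ <;>
    simp [hab.ne, hac.ne, hbc.ne, hab.ne']

/-- In a discrete 2-manifold, every edge lies in two triangles, so `2|E| = 3|T|`. -/
lemma IsDiscrete2Manifold.two_mul_card_edges {V : Type*} [Fintype V] [DecidableEq V]
    {G : SimpleGraph V} [DecidableRel G.Adj] (hG : IsDiscrete2Manifold G) :
    G.edgeFinset.card * 2 = (G.cliqueFinset 3).card * 3 := by
  refine Finset.card_mul_eq_card_mul (fun e t => e ∈ t.sym2) ?_ ?_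
  · intro e he
    induction e with
    | _ v w =>
      have h : G.Adj v w := by simpa using he
      exact (card_triangles_through_edge G h).trans (hG.card_commonNeighbors h)
  · intro t ht
    exact card_edges_of_triangle G (SimpleGraph.mem_cliqueFinset_iff.mp ht)

/-- If no vertex is isolated, the sums of the reciprocal degrees of the neighbors of all vertices
add up to the number of vertices. -/
lemma sum_sum_neighbor_one_div_degree {V : Type*} [Fintype V] [DecidableEq V]
    (G : SimpleGraph V) [DecidableRel G.Adj] (hd : ∀ v, G.degree v ≠ 0) :
    ∑ v : V, ∑ w ∈ G.neighborFinset v, (1 : ℚ) / G.degree w = Fintype.card V := by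
  rw [Finset.sum_comm' (t' := Finset.univ) (s' := fun w => G.neighborFinset w)
    (by simp [SimpleGraph.adj_comm])]
  simp [hd]

/-- Gauss–Bonnet for the vertex curvature
`K(v) = (2 − d(v))/6 + (2/3)·Σ_{w ∈ N(v)} 1/d(w)` of a discrete 2-manifold:
`Σ_v K(v) = χ(G) = |V| − |E| + |T|`. -/
theorem gaussBonnet_vertex_curvature
    {V : Type*} [Fintype V] [DecidableEq V]
    (G : SimpleGraph V) [DecidableRel G.Adj]
    (hG : IsDiscrete2Manifold G) :
    ∑ v : V, vertexCurvature G v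
      = (Fintype.card V : ℚ) - G.edgeFinset.card + (G.cliqueFinset 3).card := by
  have hd : ∀ v, G.degree v ≠ 0 := by
    intro v
    have h4 := (hG v).2.2
    rw [SimpleGraph.card_neighborSet_eq_degree] at h4
    lia
  have hdeg : ∑ v : V, (G.degree v : ℚ) = 2 * G.edgeFinset.card := by
    exact_mod_cast G.sum_degrees_eq_twice_card_edges
  have hET : (G.edgeFinset.card : ℚ) * 2 = (G.cliqueFinset 3).card * 3 := by
    exact_mod_cast hG.two_mul_card_edges
  simp only [vertexCurvature]
  rw [Finset.sum_add_distrib, ← Finset.mul_sum, sum_sum_neighbor_one_div_degree G hd,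
    ← Finset.sum_div, Finset.sum_sub_distrib, hdeg]
  simp only [Finset.sum_const, Finset.card_univ, nsmul_eq_mul]
  linarith
end

section
/- (31 theorem, boundary case) Let p = (p_1,...,p_m) be a finite list of integers with m ≥ 4 and p_k ≥ 4 for all k, and suppose Σ_{k=1}^m p_k = 32. Then the partition curvature K(p) = (2 − m)/6 + (2/3)·Σ_{k=1}^m 1/p_k satisfies K(p) ≥ 0, with equality if and only if m = 4 and p_1 = p_2 = p_3 = p_4 = 8. -/
/-- The partition curvature `K(p) = (2 − m)/6 + (2/3) · Σ_{k=1}^m 1/p_k`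
of a finite list `p = (p_1, …, p_m)` of positive integers. -/
def partitionCurvature {m : ℕ} (p : Fin m → ℕ) : ℚ :=
  ((2 : ℚ) - m) / 6 + (2 / 3) * ∑ k : Fin m, (1 : ℚ) / p k

/-- When all parts are positive and sum to 32, the curvature is a weighted sum of squared
deviations of the parts from 8. -/
theorem partitionCurvature_eq_sum_sq_div {m : ℕ} (p : Fin m → ℕ) (hp : ∀ k, 0 < p k)
    (hsum : ∑ k : Fin m, p k = 32) :
    partitionCurvature p = ∑ k : Fin m, ((p k : ℚ) - 8) ^ 2 / (96 * p k) := by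
  have hsum' : ∑ k : Fin m, (p k : ℚ) = 32 := mod_cast hsum
  have hterm : ∀ k, ((p k : ℚ) - 8) ^ 2 / (96 * p k) =
      (2 / 3) * (1 / p k) + (1 / 96) * p k - 1 / 6 := by
    intro k
    have : (p k : ℚ) ≠ 0 := mod_cast (hp k).ne'
    field_simp
    ring
  simp only [hterm, Finset.sum_sub_distrib, Finset.sum_add_distrib, ← Finset.mul_sum, hsum',
    Finset.sum_const, Finset.card_univ, Fintype.card_fin, nsmul_eq_mul, partitionCurvature]
  ring

/-- The 31 theorem (boundary case): if `p = (p_1, …, p_m)` has `m ≥ 4` parts,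
each part is at least 4, and the parts sum to exactly 32, then `K(p) ≥ 0`,
with equality if and only if `m = 4` and all four parts equal 8. -/
theorem partitionCurvature_nonneg_of_sum_eq_32
    {m : ℕ} (p : Fin m → ℕ) (hm : 4 ≤ m) (hp : ∀ k, 4 ≤ p k)
    (hsum : ∑ k : Fin m, p k = 32) :
    0 ≤ partitionCurvature p ∧
      (partitionCurvature p = 0 ↔ m = 4 ∧ ∀ k, p k = 8) := by
  have hpos : ∀ k, 0 < p k := fun k => by linarith [hp k]
  have hnonneg : ∀ k ∈ Finset.univ, 0 ≤ ((p k : ℚ) - 8) ^ 2 / (96 * p k) :=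
    fun k _ => by positivity
  rw [partitionCurvature_eq_sum_sq_div p hpos hsum]
  refine ⟨Finset.sum_nonneg hnonneg, ?_⟩
  rw [Finset.sum_eq_zero_iff_of_nonneg hnonneg]
  constructor
  · intro h
    have h8 : ∀ k, p k = 8 := by
      intro k
      have hk := h k (Finset.mem_univ k)
      have hne : (96 * p k : ℚ) ≠ 0 := by exact_mod_cast (Nat.mul_pos (by norm_num) (hpos k)).ne'
      rw [div_eq_zero_iff, or_iff_left hne, sq_eq_zero_iff, sub_eq_zero] at hk
      exact_mod_cast hk
    refine ⟨?_, h8⟩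
    simp only [h8, Finset.sum_const, Finset.card_univ, Fintype.card_fin, smul_eq_mul] at hsum
    omega
  · rintro ⟨-, h8⟩ k -
    simp [h8 k]
end

section
/- Let p = (p_1,...,p_m) be a finite list of integers with m ≥ 4 and p_k ≥ 4 for all k, and suppose Σ_{k=1}^m p_k ≤ 33. Then the partition curvature K(p) = (2 − m)/6 + (2/3)·Σ_{k=1}^m 1/p_k is negative if and only if the multiset {p_1,...,p_m} is one of {10,9,7,7}, {10,8,8,7}, {9,9,8,7}, {9,8,8,8}; in these cases K(p) equals −2/945, −1/210, −5/756 and −1/108 respectively. -/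
/-- The partition curvature depends only on the multiset of parts. -/
theorem partitionCurvature_eq_of_map_eq {m : ℕ} (p : Fin m → ℕ) {s : Multiset ℕ}
    (h : Multiset.map p Finset.univ.val = s) :
    partitionCurvature p =
      ((2 : ℚ) - s.card) / 6 + (2 / 3) * (s.map fun n : ℕ => (1 : ℚ) / n).sum := by
  subst h
  simp [partitionCurvature, Finset.sum, Function.comp_def]

/-- The tangent line of `x ↦ 1 / x` at a positive `c` lies below the graph. -/
theorem two_div_sub_div_sq_le_one_div {c x : ℚ} (hc : 0 < c) (hx : 0 < x) :
    2 / c - x / c ^ 2 ≤ 1 / x := by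
  have h : 1 / x - (2 / c - x / c ^ 2) = (x - c) ^ 2 / (x * c ^ 2) := by
    field_simp
    ring
  have : 0 ≤ (x - c) ^ 2 / (x * c ^ 2) := by positivity
  linarith

/-- With at least five parts of total at most 33, the curvature is nonnegative. -/
theorem partitionCurvature_nonneg_of_five_le {m : ℕ} (p : Fin m → ℕ) (hm : 5 ≤ m)
    (hp : ∀ k, 0 < p k) (hsum : ∑ k : Fin m, p k ≤ 33) : 0 ≤ partitionCurvature p := by
  have hle : ∑ k : Fin m, ((2 : ℚ) / 6 - (p k : ℚ) / 6 ^ 2) ≤ ∑ k : Fin m, (1 : ℚ) / p k :=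
    Finset.sum_le_sum fun k _ =>
      two_div_sub_div_sq_le_one_div (by norm_num) (by exact_mod_cast hp k)
  simp only [Finset.sum_sub_distrib, ← Finset.sum_div, Finset.sum_const, Finset.card_univ, Fintype.card_fin, nsmul_eq_mul] at hle
  have hsum' : ∑ k : Fin m, (p k : ℚ) ≤ 33 := by exact_mod_cast hsum
  have hm' : (5 : ℚ) ≤ m := by exact_mod_cast hm
  unfold partitionCurvature
  linarith

/-- If four positive integers have sum at most 33 and reciprocal sum below `1 / 2`,
each of them lies between 6 and 11. -/
theorem mem_Icc_of_sum_one_div_lt (p : Fin 4 → ℕ) (hp : ∀ k, 0 < p k)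
    (hsum : ∑ k, p k ≤ 33) (hlt : ∑ k, (1 : ℚ) / p k < 1 / 2) (j : Fin 4) :
    p j ∈ Finset.Icc 6 11 := by
  have hpos : (0 : ℚ) < p j := by exact_mod_cast hp j
  have hexcess : (1 : ℚ) / p j - (2 / 8 - (p j : ℚ) / 8 ^ 2) ≤
      ∑ k, ((1 : ℚ) / p k - (2 / 8 - (p k : ℚ) / 8 ^ 2)) :=
    Finset.single_le_sum (f := fun k => (1 : ℚ) / p k - (2 / 8 - (p k : ℚ) / 8 ^ 2))
      (fun k _ => sub_nonneg.mpr
        (two_div_sub_div_sq_le_one_div (by norm_num) (by exact_mod_cast hp k)))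
      (Finset.mem_univ j)
  simp only [Finset.sum_sub_distrib, ← Finset.sum_div, Finset.sum_const, Finset.card_univ, Fintype.card_fin, nsmul_eq_mul] at hexcess
  have hsum' : ∑ k, (p k : ℚ) ≤ 33 := by exact_mod_cast hsum
  have hinv : (1 : ℚ) / p j < 17 / 64 - (p j : ℚ) / 64 := by
    push_cast at hexcess
    linarith
  rw [div_lt_iff₀ hpos] at hinv
  rw [Finset.mem_Icc]
  constructor <;> by_contra! h
  · have : (p j : ℚ) ≤ 5 := by exact_mod_cast Nat.le_of_lt_succ h
    nlinarith
  · have : (12 : ℚ) ≤ p j := by exact_mod_cast h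
    nlinarith

/-- The quadruples in `[6, 11]` of sum at most 33 and reciprocal sum below `1 / 2`,
the latter condition being cleared of denominators. -/
theorem quadruple_mem_of_sum_le_33 : ∀ a ∈ Finset.Icc 6 11, ∀ b ∈ Finset.Icc 6 11,
    ∀ c ∈ Finset.Icc 6 11, ∀ d ∈ Finset.Icc 6 11, a + b + c + d ≤ 33 →
    2 * (b * c * d + a * c * d + a * b * d + a * b * c) < a * b * c * d →
    ({a, b, c, d} : Multiset ℕ) = {10, 9, 7, 7} ∨ ({a, b, c, d} : Multiset ℕ) = {10, 8, 8, 7} ∨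
    ({a, b, c, d} : Multiset ℕ) = {9, 9, 8, 7} ∨ ({a, b, c, d} : Multiset ℕ) = {9, 8, 8, 8} := by
  decide +kernel

/-- If `p = (p_1, …, p_m)` has `m ≥ 4` parts, each part at least 4, and the parts
sum to at most 33, then `K(p) < 0` iff the multiset of parts is one of
`{10,9,7,7}`, `{10,8,8,7}`, `{9,9,8,7}`, `{9,8,8,8}`; in these cases `K(p)` equals
`−2/945`, `−1/210`, `−5/756`, `−1/108` respectively. -/
theorem partitionCurvature_neg_iff_of_sum_le_33
    {m : ℕ} (p : Fin m → ℕ) (hm : 4 ≤ m) (hp : ∀ k, 4 ≤ p k)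
    (hsum : ∑ k : Fin m, p k ≤ 33) :
    (partitionCurvature p < 0 ↔
      Multiset.map p Finset.univ.val = ({10, 9, 7, 7} : Multiset ℕ) ∨
      Multiset.map p Finset.univ.val = ({10, 8, 8, 7} : Multiset ℕ) ∨
      Multiset.map p Finset.univ.val = ({9, 9, 8, 7} : Multiset ℕ) ∨
      Multiset.map p Finset.univ.val = ({9, 8, 8, 8} : Multiset ℕ)) ∧
    (Multiset.map p Finset.univ.val = ({10, 9, 7, 7} : Multiset ℕ) →
      partitionCurvature p = -(2 / 945)) ∧
    (Multiset.map p Finset.univ.val = ({10, 8, 8, 7} : Multiset ℕ) →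
      partitionCurvature p = -(1 / 210)) ∧
    (Multiset.map p Finset.univ.val = ({9, 9, 8, 7} : Multiset ℕ) →
      partitionCurvature p = -(5 / 756)) ∧
    (Multiset.map p Finset.univ.val = ({9, 8, 8, 8} : Multiset ℕ) →
      partitionCurvature p = -(1 / 108)) := by
  have h₁ (h : Multiset.map p Finset.univ.val = ({10, 9, 7, 7} : Multiset ℕ)) :
      partitionCurvature p = -(2 / 945) := by
    rw [partitionCurvature_eq_of_map_eq p h]
    norm_num
  have h₂ (h : Multiset.map p Finset.univ.val = ({10, 8, 8, 7} : Multiset ℕ)) :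
      partitionCurvature p = -(1 / 210) := by
    rw [partitionCurvature_eq_of_map_eq p h]
    norm_num
  have h₃ (h : Multiset.map p Finset.univ.val = ({9, 9, 8, 7} : Multiset ℕ)) :
      partitionCurvature p = -(5 / 756) := by
    rw [partitionCurvature_eq_of_map_eq p h]
    norm_num
  have h₄ (h : Multiset.map p Finset.univ.val = ({9, 8, 8, 8} : Multiset ℕ)) :
      partitionCurvature p = -(1 / 108) := by
    rw [partitionCurvature_eq_of_map_eq p h]
    norm_num
  refine ⟨⟨fun hneg => ?_, ?_⟩, h₁, h₂, h₃, h₄⟩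
  · have hpos (k : Fin m) : 0 < p k := by have := hp k; omega
    obtain rfl : m = 4 := by
      by_contra hne
      exact hneg.not_ge (partitionCurvature_nonneg_of_five_le p (by omega) hpos hsum)
    have hlt : ∑ k, (1 : ℚ) / p k < 1 / 2 := by
      unfold partitionCurvature at hneg
      push_cast at hneg
      linarith
    have hmem := mem_Icc_of_sum_one_div_lt p hpos hsum hlt
    refine quadruple_mem_of_sum_le_33 (p 0) (hmem 0) (p 1) (hmem 1) (p 2) (hmem 2) (p 3) (hmem 3)
      (by simpa [Fin.sum_univ_four] using hsum) ?_
    have hposQ (k : Fin 4) : (0 : ℚ) < p k := by exact_mod_cast hpos k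
    have h0 := hposQ 0
    have h1 := hposQ 1
    have h2 := hposQ 2
    have h3 := hposQ 3
    rw [Fin.sum_univ_four] at hlt
    have hclear : (1 : ℚ) / p 0 + 1 / p 1 + 1 / p 2 + 1 / p 3 =
        (p 1 * p 2 * p 3 + p 0 * p 2 * p 3 + p 0 * p 1 * p 3 + p 0 * p 1 * p 2) /
          (p 0 * p 1 * p 2 * p 3) := by
      field_simp
    rw [hclear, div_lt_iff₀ (by positivity)] at hlt
    have : (2 : ℚ) * (p 1 * p 2 * p 3 + p 0 * p 2 * p 3 + p 0 * p 1 * p 3 + p 0 * p 1 * p 2) <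
        p 0 * p 1 * p 2 * p 3 := by
      linarith
    exact_mod_cast this
  · rintro (h | h | h | h)
    · norm_num [h₁ h]
    · norm_num [h₂ h]
    · norm_num [h₃ h]
    · norm_num [h₄ h]
end

section
/- Let G be a discrete 2-manifold, i.e. a finite simple graph in which, for every vertex v, the subgraph induced on the neighborhood N(v) is connected, 2-regular, and has at least 4 vertices. If the unit sphere vertex degree Σ_{w ∈ N(v)} d(w) is at most 31 for every vertex v, then the curvature K(v) = (2 − d(v))/6 + (2/3)·Σ_{w ∈ N(v)} 1/d(w) is strictly positive at every vertex v. -/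
/-- Tangent line bound for the reciprocal: `1 / x ≥ 2 t - t² x` for `x > 0`. -/
theorem two_mul_sub_sq_mul_le_one_div {K : Type*} [Field K] [LinearOrder K]
    [IsStrictOrderedRing K] {x : K} (hx : 0 < x) (t : K) : 2 * t - t ^ 2 * x ≤ 1 / x := by
  rw [le_div_iff₀ hx]
  nlinarith [sq_nonneg (t * x - 1)]

/-- If in a discrete 2-manifold the unit sphere vertex degree
`Σ_{w ∈ N(v)} d(w)` is at most 31 at every vertex, then the curvature
`K(v)` is strictly positive at every vertex. -/
theorem vertexCurvature_pos_of_sphereDegree_le_31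
    {V : Type*} [Fintype V] [DecidableEq V]
    (G : SimpleGraph V) [DecidableRel G.Adj]
    (hG : IsDiscrete2Manifold G)
    (h31 : ∀ v : V, ∑ w ∈ G.neighborFinset v, G.degree w ≤ 31) :
    ∀ v : V, 0 < vertexCurvature G v := by
  intro v
  have hpos : ∀ w ∈ G.neighborFinset v, (0 : ℚ) < G.degree w := fun w hw => by
    have hvw : G.Adj v w := by simpa using hw
    exact_mod_cast (G.degree_pos_iff_exists_adj w).2 ⟨v, hvw.symm⟩
  have hsum : (∑ w ∈ G.neighborFinset v, (G.degree w : ℚ)) ≤ 31 := by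
    exact_mod_cast h31 v
  -- The Cauchy–Schwarz bound `∑ 1 / d(w) ≥ d(v)² / 31`.
  have hrecip : (G.degree v : ℚ) ^ 2 / 31 ≤
      ∑ w ∈ G.neighborFinset v, (1 : ℚ) / G.degree w := by
    have hle := Finset.sum_le_sum fun w hw =>
      two_mul_sub_sq_mul_le_one_div (hpos w hw) ((G.degree v : ℚ) / 31)
    rw [Finset.sum_sub_distrib, Finset.sum_const, ← Finset.mul_sum,
      G.card_neighborFinset_eq_degree, nsmul_eq_mul] at hle
    have hmul := mul_le_mul_of_nonneg_left hsum (sq_nonneg ((G.degree v : ℚ) / 31))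
    linarith
  unfold vertexCurvature
  nlinarith [sq_nonneg (8 * (G.degree v : ℚ) - 31)]
end
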